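/- Let p, q be integers with 2 ≤ p < q, gcd(p,q) = 1, q even (hence p odd), and write q = r·p + s with integers r ≥ 1 and 0 < s < p. Let Q ⊂ ℝ³ be the convex hull of the six points (0,0,0), (1,0,0), (0,0,1), (1,p,q), (1,0,1), (2,p,q). Then (1,1,r+1) is a lattice point of Q (indeed (1,1,r+1) = (1/p)·[(1,p,q) + (p−s)·(1,0,1) + (s−1)·(1,0,0)] is a convex combination of the listed points) and it is distinct from each of the six listed points; consequently Q contains at least 7 lattice points of ℤ³. -/

import Mathlib

open scoped BigOperators

noncomputable section

/-- the six listed points of ℝ³ -/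
def sixPts (p q : ℤ) : Set (Fin 3 → ℝ) :=
  {![(0:ℝ),0,0], ![(1:ℝ),0,0], ![(0:ℝ),0,1], ![(1:ℝ),(p:ℝ),(q:ℝ)],
   ![(1:ℝ),0,1], ![(2:ℝ),(p:ℝ),(q:ℝ)]}

/-- Q = conv{(0,0,0),(1,0,0),(0,0,1),(1,p,q),(1,0,1),(2,p,q)} -/
def Qhull (p q : ℤ) : Set (Fin 3 → ℝ) := convexHull ℝ (sixPts p q)

/-- `Q` is contained in the box `[0, 2] × [0, p] × [0, q]`. -/
theorem Qhull_subset_Icc {p q : ℤ} (hp : 0 ≤ p) (hq : 1 ≤ q) :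
    Qhull p q ⊆ Set.Icc ![(0:ℝ), 0, 0] ![(2:ℝ), (p:ℝ), (q:ℝ)] := by
  have hp' : (0:ℝ) ≤ p := by exact_mod_cast hp
  have hq' : (1:ℝ) ≤ q := by exact_mod_cast hq
  have hq0 : (0:ℝ) ≤ q := zero_le_one.trans hq'
  refine convexHull_min ?_ (convex_Icc _ _)
  rintro x (rfl | rfl | rfl | rfl | rfl | rfl) <;>
    simp [Pi.le_def, Fin.forall_fin_succ, hp', hq', hq0]

/-- `Q` contains only finitely many lattice points. -/
theorem finite_latticePoints_Qhull {p q : ℤ} (hp : 0 ≤ p) (hq : 1 ≤ q) :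
    {m : Fin 3 → ℤ | (fun i => (m i : ℝ)) ∈ Qhull p q}.Finite := by
  refine (Set.finite_Icc (![0, 0, 0] : Fin 3 → ℤ) ![2, p, q]).subset fun m hm => ?_
  have h := Qhull_subset_Icc hp hq hm
  simp only [Set.mem_Icc, Pi.le_def, Fin.forall_fin_succ] at h ⊢
  simp at h ⊢
  exact_mod_cast h

/-- for 2 ≤ p < q coprime, q even, q = r·p + s with r ≥ 1, 0 < s < p,
the lattice point (1,1,r+1) lies in Q (via the displayed convex combination), is distinct
from the six listed points, and hence Q contains at least 7 lattice points. -/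
theorem stmt13 (p q r s : ℤ) (hp : 2 ≤ p) (hpq : p < q) (hgcd : Int.gcd p q = 1)
    (hq : Even q) (hr : 1 ≤ r) (hs : 0 < s) (hsp : s < p) (hqrs : q = r * p + s) :
    ((p:ℝ)⁻¹ • (![(1:ℝ),(p:ℝ),(q:ℝ)] + ((p:ℝ) - (s:ℝ)) • ![(1:ℝ),0,1]
        + ((s:ℝ) - 1) • ![(1:ℝ),0,0]) = ![(1:ℝ),1,(r:ℝ)+1]) ∧
    ![(1:ℝ),1,(r:ℝ)+1] ∈ Qhull p q ∧
    (∃ m : Fin 3 → ℤ, (fun i => (m i : ℝ)) = ![(1:ℝ),1,(r:ℝ)+1]) ∧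
    ![(1:ℝ),1,(r:ℝ)+1] ∉ sixPts p q ∧
    7 ≤ Set.ncard {m : Fin 3 → ℤ | (fun i => (m i : ℝ)) ∈ Qhull p q} := by
  have hp0 : (0:ℝ) < p := by exact_mod_cast (by omega : 0 < p)
  have hqR : (q:ℝ) = r * p + s := by exact_mod_cast hqrs
  have hs1 : (1:ℝ) ≤ s := by exact_mod_cast (by omega : 1 ≤ s)
  have hspR : (s:ℝ) ≤ p := by exact_mod_cast hsp.le
  have hcomb : (p:ℝ)⁻¹ • (![(1:ℝ),(p:ℝ),(q:ℝ)] + ((p:ℝ) - (s:ℝ)) • ![(1:ℝ),0,1]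
        + ((s:ℝ) - 1) • ![(1:ℝ),0,0]) = ![(1:ℝ),1,(r:ℝ)+1] := by
    ext i
    fin_cases i <;> simp <;> field_simp <;> linarith
  have hsub : sixPts p q ⊆ Qhull p q := subset_convexHull ℝ _
  have hmem : ![(1:ℝ),1,(r:ℝ)+1] ∈ Qhull p q := by
    have hsum := (convex_convexHull ℝ (sixPts p q)).sum_mem
      (t := Finset.univ)
      (w := ![(p:ℝ)⁻¹, (p:ℝ)⁻¹ * (p - s), (p:ℝ)⁻¹ * (s - 1)])
      (z := ![![(1:ℝ),(p:ℝ),(q:ℝ)], ![(1:ℝ),0,1], ![(1:ℝ),0,0]])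
      (by
        have h1 : 0 ≤ (p:ℝ)⁻¹ * (p - s) := mul_nonneg (by positivity) (by linarith)
        have h2 : 0 ≤ (p:ℝ)⁻¹ * (s - 1) := mul_nonneg (by positivity) (by linarith)
        simp [Fin.forall_fin_succ, h1, h2, hp0.le])
      (by simp [Fin.sum_univ_succ]; field_simp; ring)
      (by
        intro i _
        apply hsub
        fin_cases i <;> simp [sixPts])
    rw [← hcomb]
    simpa only [Qhull, Fin.sum_univ_three, smul_add, smul_smul, Matrix.cons_val] using hsum
  have hp1 : (1:ℝ) ≠ p := by exact_mod_cast (by omega : (1:ℤ) ≠ p)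
  refine ⟨hcomb, hmem, ⟨![1, 1, r + 1], ?_⟩, ?_, ?_⟩
  · ext i
    fin_cases i <;> simp
  · simp [sixPts, hp1]
  · let T : Finset (Fin 3 → ℤ) := {![1, 1, r + 1], ![0, 0, 0], ![1, 0, 0], ![0, 0, 1],
      ![1, p, q], ![1, 0, 1], ![2, p, q]}
    have hT : T.card = 7 := by
      have h1 : (1:ℤ) ≠ p := by omega
      have h0 : (0:ℤ) ≠ p := by omega
      simp [T, Finset.card_insert_of_notMem, h1, h0, h0.symm]
    rw [← hT, ← Set.ncard_coe_finset]
    refine Set.ncard_le_ncard ?_ (finite_latticePoints_Qhull (by omega) (by omega))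
    have hcast (a b c : ℤ) : (fun i => ((![a, b, c] : Fin 3 → ℤ) i : ℝ)) =
        ![(a:ℝ), (b:ℝ), (c:ℝ)] := by
      ext i
      fin_cases i <;> rfl
    intro m hm
    simp only [T, Finset.coe_insert, Finset.coe_singleton] at hm
    rcases hm with rfl | rfl | rfl | rfl | rfl | rfl | rfl <;>
      rw [Set.mem_ofPred_eq, hcast]
    · simpa using hmem
    all_goals
      apply hsub
      simp [sixPts]

end
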